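/- In the setup below, let X be a minimal vertex cut of G with {u3, u4} ⊆ X ⊆ N[{u3, u4}] and X ∩ V(H) = {u3, u4}, and let G1 be the induced subgraph of G whose vertex set consists of X together with the vertex set of the component of G − X containing the interior P2* of P2. Then every induced (u3, u4)-path in G1 has length |P2|. -/

import Mathlib

open SimpleGraph

variable {V : Type*}

/-- The list of internal vertices of a walk (its support minus the two ends). -/
def interiorL {G : SimpleGraph V} {a b : V} (p : G.Walk a b) : List V :=
  p.support.tail.dropLast

/-- `p` is an induced path of `G`: a path such that the only edges of `G` between
vertices of `p` are the edges of `p`. -/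
def IsInducedPath (G : SimpleGraph V) {a b : V} (p : G.Walk a b) : Prop :=
  p.IsPath ∧ ∀ x ∈ p.support, ∀ y ∈ p.support, G.Adj x y → s(x, y) ∈ p.edges

/-- A hole of `G`: an induced (chordless) cycle of length at least 4. -/
def IsHole (G : SimpleGraph V) {v : V} (c : G.Walk v v) : Prop :=
  c.IsCycle ∧ 4 ≤ c.length ∧
    ∀ x ∈ c.support, ∀ y ∈ c.support, G.Adj x y → s(x, y) ∈ c.edges

/-- An odd hole of `G`: a hole of odd length. -/
def IsOddHole (G : SimpleGraph V) {v : V} (c : G.Walk v v) : Prop :=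
  IsHole G c ∧ Odd c.length

/-- `G ∈ 𝒢ℓ`: `G` has girth `2ℓ+1` and every odd hole of `G` has length exactly `2ℓ+1`
(equivalently, no odd hole of length at least `2ℓ+3`). -/
def InGFamily (ℓ : ℕ) (G : SimpleGraph V) : Prop :=
  G.egirth = (2 * ℓ + 1 : ℕ) ∧
    ∀ (v : V) (c : G.Walk v v), IsOddHole G c → c.length = 2 * ℓ + 1

/-- `G` is `k`-vertex-critical: `χ(G) = k` and `χ(G − v) < k` for every vertex `v`. -/
def VertexCritical (k : ℕ) (G : SimpleGraph V) : Prop :=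
  G.chromaticNumber = (k : ℕ∞) ∧
    ∀ v : V, (G.induce ({v}ᶜ : Set V)).chromaticNumber < (k : ℕ∞)

/-- An odd `K₄`-subdivision in `G`: four distinct branch vertices `u1, u2, u3, u4`
joined by six internally disjoint paths (the arrises), such that the four face cycles
are all odd holes of `G`. -/
structure OddK4 (G : SimpleGraph V) where
  u1 : V
  u2 : V
  u3 : V
  u4 : V
  /-- the arris joining `u1` and `u2` -/
  P1 : G.Walk u1 u2
  /-- the arris joining `u3` and `u4` -/
  P2 : G.Walk u3 u4
  /-- the arris joining `u2` and `u3` -/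
  Q1 : G.Walk u2 u3
  /-- the arris joining `u1` and `u4` -/
  Q2 : G.Walk u1 u4
  /-- the arris joining `u1` and `u3` -/
  L1 : G.Walk u1 u3
  /-- the arris joining `u2` and `u4` -/
  L2 : G.Walk u2 u4
  hP1 : P1.IsPath
  hP2 : P2.IsPath
  hQ1 : Q1.IsPath
  hQ2 : Q2.IsPath
  hL1 : L1.IsPath
  hL2 : L2.IsPath
  /-- the four branch vertices are pairwise distinct -/
  hnodup : List.Nodup [u1, u2, u3, u4]
  /-- the interiors of the six arrises are pairwise disjoint -/
  hdisj : List.Pairwise List.Disjoint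
    [interiorL P1, interiorL P2, interiorL Q1, interiorL Q2, interiorL L1, interiorL L2]
  /-- no branch vertex lies in the interior of an arris -/
  hbranch : ∀ x ∈ interiorL P1 ++ interiorL P2 ++ interiorL Q1 ++ interiorL Q2 ++
      interiorL L1 ++ interiorL L2, x ∉ [u1, u2, u3, u4]
  /-- the face `u1u2u3` is an odd hole of `G` -/
  face1 : IsOddHole G (P1.append (Q1.append L1.reverse))
  /-- the face `u1u2u4` is an odd hole of `G` -/
  face2 : IsOddHole G (P1.append (L2.append Q2.reverse))
  /-- the face `u1u3u4` is an odd hole of `G` -/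
  face3 : IsOddHole G (L1.append (P2.append Q2.reverse))
  /-- the face `u2u3u4` is an odd hole of `G` -/
  face4 : IsOddHole G (Q1.append (P2.append L2.reverse))

/-- The subgraph of `G` formed by an odd `K₄`-subdivision. -/
def OddK4.toSubgraph {G : SimpleGraph V} (K : OddK4 G) : G.Subgraph :=
  K.P1.toSubgraph ⊔ K.P2.toSubgraph ⊔ K.Q1.toSubgraph ⊔ K.Q2.toSubgraph ⊔
    K.L1.toSubgraph ⊔ K.L2.toSubgraph

/-- The vertex set of an odd `K₄`-subdivision. -/
def OddK4.verts {G : SimpleGraph V} (K : OddK4 G) : Set V :=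
  K.toSubgraph.verts

/-- `X` is a vertex cut of `G`: deleting `X` leaves a disconnected graph. -/
def IsVertexCut (G : SimpleGraph V) (X : Set V) : Prop :=
  ¬ (G.induce (Xᶜ : Set V)).Preconnected

/-- `v` is a cut-vertex (`K₁`-cut) of `G`: some two vertices are connected in `G`
but not in `G − v`. -/
def IsCutVertex (G : SimpleGraph V) (v : V) : Prop :=
  ∃ a b : V, ∃ (ha : a ∈ ({v}ᶜ : Set V)) (hb : b ∈ ({v}ᶜ : Set V)),
    G.Reachable a b ∧ ¬ (G.induce ({v}ᶜ : Set V)).Reachable ⟨a, ha⟩ ⟨b, hb⟩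

/-- `G` has a `K₂`-cut: a pair of adjacent vertices whose deletion disconnects `G`. -/
def HasK2Cut (G : SimpleGraph V) : Prop :=
  ∃ u v : V, G.Adj u v ∧ ¬ (G.induce (({u, v} : Set V)ᶜ)).Preconnected

/-- `G` has a `P₃`-cut: a path on three vertices whose deletion disconnects `G`. -/
def HasP3Cut (G : SimpleGraph V) : Prop :=
  ∃ u v w : V, G.Adj u v ∧ G.Adj v w ∧ u ≠ w ∧
    ¬ (G.induce (({u, v, w} : Set V)ᶜ)).Preconnected

/-- The closed neighbourhood `N[S]` of a set `S` of vertices. -/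
def closedNbhd (G : SimpleGraph V) (S : Set V) : Set V :=
  S ∪ {v | ∃ u ∈ S, G.Adj u v}

/-- `S` is the vertex set of a (connected) component of `G − X`. -/
def IsComponentOf (G : SimpleGraph V) (X S : Set V) : Prop :=
  S.Nonempty ∧ Disjoint S X ∧ (G.induce S).Connected ∧
    ∀ a ∈ S, ∀ b, b ∉ S → b ∉ X → ¬ G.Adj a b

/-- `P1, P2` form a pair of longest arrises of the odd `K₄`-subdivision `K`. -/
def OddK4.longestPair {G : SimpleGraph V} (K : OddK4 G) : Prop :=
  K.Q1.length ≤ K.P1.length ∧ K.Q2.length ≤ K.P1.length ∧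
    K.L1.length ≤ K.P1.length ∧ K.L2.length ≤ K.P1.length ∧
    K.Q1.length ≤ K.P2.length ∧ K.Q2.length ≤ K.P2.length ∧
    K.L1.length ≤ K.P2.length ∧ K.L2.length ≤ K.P2.length

/-- The difference `d(H) = |P1| − min(|Q1|, |L1|)` of an odd `K₄`-subdivision
(labelled so that `P1, P2` is a pair of longest arrises). -/
def OddK4.diff {G : SimpleGraph V} (K : OddK4 G) : ℕ :=
  K.P1.length - min K.Q1.length K.L1.length

section Walks

variable {G : SimpleGraph V} {a b c : V}

lemma exists_isInducedPath_support_subset (w : G.Walk a b) :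
    ∃ p : G.Walk a b, IsInducedPath G p ∧ p.support ⊆ w.support := by
  classical
  induction hn : w.length using Nat.strong_induction_on generalizing w with
  | _ n ih =>
  set p := w.bypass with hp
  have hpath : p.IsPath := w.bypass_isPath
  have hsub : p.support ⊆ w.support := w.support_bypass_subset_support
  have hlen : p.length ≤ n := hn ▸ w.length_bypass_le_length
  by_cases hind : IsInducedPath G p
  · exact ⟨p, hind, hsub⟩
  have key : ∀ i j, i < j → j ≤ p.length → G.Adj (p.getVert i) (p.getVert j) →
      s(p.getVert i, p.getVert j) ∉ p.edges →
      ∃ q : G.Walk a b, IsInducedPath G q ∧ q.support ⊆ w.support := by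
    intro i j hij hj hadj he
    have hne : j ≠ i + 1 := by
      rintro rfl
      exact he ((p.mk_mem_edges_iff_exists).2 ⟨i, by omega, rfl⟩)
    obtain ⟨q, hq, hqs⟩ := ih ((p.take i).append (.cons hadj (p.drop j))).length
      (by simp [Walk.take_length, Walk.drop_length]; omega) _ rfl
    refine ⟨q, hq, fun x hx => hsub ?_⟩
    have := hqs hx
    rw [Walk.mem_support_append_iff, Walk.support_cons, List.mem_cons] at this
    rcases this with h | rfl | h
    · exact (p.isSubwalk_take i).support_subset h
    · exact p.getVert_mem_support i
    · exact (p.isSubwalk_drop j).support_subset h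
  simp only [IsInducedPath, hpath, true_and, not_forall] at hind
  obtain ⟨x, hx, y, hy, hadj, he⟩ := hind
  obtain ⟨i, rfl, hi⟩ := Walk.mem_support_iff_exists_getVert.1 hx
  obtain ⟨j, rfl, hj⟩ := Walk.mem_support_iff_exists_getVert.1 hy
  rcases lt_trichotomy i j with h | rfl | h
  · exact key i j h hj hadj he
  · exact (G.irrefl hadj).elim
  · exact key j i h hi hadj.symm (by rwa [Sym2.eq_swap])

lemma IsInducedPath.eq_add_one_of_adj {p : G.Walk a b} (hp : IsInducedPath G p) {i j : ℕ}
    (hi : i ≤ p.length) (hj : j ≤ p.length) (h : G.Adj (p.getVert i) (p.getVert j)) :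
    i = j + 1 ∨ j = i + 1 := by
  have he := hp.2 _ (p.getVert_mem_support i) _ (p.getVert_mem_support j) h
  obtain ⟨k, hk, he⟩ := p.mk_mem_edges_iff_exists.1 he
  have inj : ∀ m n, m ≤ p.length → n ≤ p.length → p.getVert m = p.getVert n → m = n :=
    fun m n hm hn h => hp.1.getVert_injOn hm hn h
  rcases Sym2.eq_iff.1 he with ⟨h1, h2⟩ | ⟨h1, h2⟩
  · have := inj _ _ (by omega) hi h1
    have := inj _ _ (by omega) hj h2
    omega
  · have := inj _ _ (by omega) hj h1
    have := inj _ _ (by omega) hi h2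
    omega

lemma isPath_append {p : G.Walk a b} {q : G.Walk b c} (hp : p.IsPath) (hq : q.IsPath)
    (h : ∀ x ∈ p.support, x ∈ q.support → x = b) : (p.append q).IsPath := by
  rw [Walk.isPath_def, Walk.support_append, List.nodup_append']
  refine ⟨hp.support_nodup, hq.support_nodup.tail, fun x hx hx' => ?_⟩
  obtain rfl := h x hx (List.mem_of_mem_tail hx')
  have := hq.support_nodup
  rw [← Walk.cons_tail_support, List.nodup_cons] at this
  exact this.1 hx'

lemma two_le_length_of_not_adj (hab : a ≠ b) (hnab : ¬ G.Adj a b) (p : G.Walk a b) :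
    2 ≤ p.length := by
  by_contra h
  have : p.length = 0 ∨ p.length = 1 := by omega
  rcases this with h | h
  · exact hab (Walk.eq_of_length_eq_zero h)
  · exact hnab (Walk.adj_of_length_eq_one h)

lemma isHole_append_reverse {p q : G.Walk a b} (hp : IsInducedPath G p) (hq : IsInducedPath G q)
    (hab : a ≠ b) (hnab : ¬ G.Adj a b)
    (hpq : ∀ x ∈ p.support, x ∈ q.support → x = a ∨ x = b)
    (hadj : ∀ x ∈ p.support, ∀ y ∈ q.support, G.Adj x y → x = a ∨ x = b ∨ y = a ∨ y = b) :
    IsHole G (p.append q.reverse) := by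
  have hp2 := two_le_length_of_not_adj hab hnab p
  have hq2 := two_le_length_of_not_adj hab hnab q
  have cross : ∀ x ∈ p.support, ∀ y ∈ q.support, G.Adj x y →
      s(x, y) ∈ p.edges ∨ s(x, y) ∈ q.edges := by
    intro x hx y hy h
    rcases hadj x hx y hy h with rfl | rfl | rfl | rfl
    · exact Or.inr (hq.2 _ q.start_mem_support _ hy h)
    · exact Or.inr (hq.2 _ q.end_mem_support _ hy h)
    · exact Or.inl (hp.2 _ hx _ p.start_mem_support h)
    · exact Or.inl (hp.2 _ hx _ p.end_mem_support h)
  refine ⟨hp.1.isCycle_append hq.1.reverse ?_ (by omega), by simp; omega, ?_⟩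
  · intro x hx hx'
    have h1 := hp.1.support_nodup
    have h2 := hq.1.reverse.support_nodup
    rw [← Walk.cons_tail_support, List.nodup_cons] at h1 h2
    rcases hpq x (List.mem_of_mem_tail hx)
      (by simpa using List.mem_of_mem_tail hx') with rfl | rfl
    · exact h1.1 hx
    · exact h2.1 hx'
  · intro x hx y hy h
    simp only [Walk.mem_support_append_iff, Walk.support_reverse, List.mem_reverse,
      Walk.edges_append, Walk.edges_reverse, List.mem_append] at hx hy ⊢
    rcases hx with hx | hx <;> rcases hy with hy | hy
    · exact Or.inl (hp.2 _ hx _ hy h)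
    · exact cross x hx y hy h
    · rw [Sym2.eq_swap]
      exact cross y hy x hx h.symm
    · exact Or.inr (hq.2 _ hx _ hy h)

lemma IsHole.isInducedPath {v : V} {c : G.Walk v v} (hc : IsHole G c) {t z : G.Walk a b}
    (ht : t.IsPath) (hz : z.IsPath) (hz2 : 2 ≤ z.length) (hts : t.support ⊆ c.support)
    (hce : ∀ e ∈ c.edges, e ∈ t.edges ∨ e ∈ z.edges)
    (htz : ∀ x ∈ t.support, x ∈ z.support → x = a ∨ x = b) : IsInducedPath G t := by
  refine ⟨ht, fun x hx y hy h => ?_⟩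
  rcases hce _ (hc.2.2 x (hts hx) y (hts hy) h) with he | he
  · exact he
  exfalso
  have hne := h.ne
  have : s(a, b) ∈ z.edges := by
    rcases htz x hx (z.fst_mem_support_of_mem_edges he) with rfl | rfl <;>
      rcases htz y hy (z.snd_mem_support_of_mem_edges he) with rfl | rfl
    · exact (hne rfl).elim
    · exact he
    · rwa [Sym2.eq_swap]
    · exact (hne rfl).elim
  have := hz.length_eq_one_of_mem_edges this
  omega

lemma isInducedPath_append_append {d : V} {p : G.Walk a b} {q : G.Walk b c} {r : G.Walk c d}
    (hpq : IsInducedPath G (p.append q)) (hqr : IsInducedPath G (q.append r))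
    (hpr : ∀ x ∈ p.support, x ∈ r.support → False)
    (hadj : ∀ x ∈ p.support, ∀ y ∈ r.support, x ≠ b → y ≠ c → ¬ G.Adj x y) :
    IsInducedPath G (p.append (q.append r)) := by
  have hnd := hpq.1.support_nodup
  rw [Walk.support_append, List.nodup_append'] at hnd
  have cross : ∀ x ∈ p.support, ∀ y ∈ r.support, G.Adj x y →
      s(x, y) ∈ p.edges ∨ s(x, y) ∈ q.edges ∨ s(x, y) ∈ r.edges := by
    intro x hx y hy h
    by_cases hxb : x = b
    · subst hxb
      have := hqr.2 x (by simp) y (by simp [hy]) h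
      simp only [Walk.edges_append, List.mem_append] at this
      exact Or.inr this
    by_cases hyc : y = c
    · subst hyc
      have := hpq.2 x (by simp [hx]) y (by simp) h
      simp only [Walk.edges_append, List.mem_append] at this
      tauto
    exact (hadj x hx y hy hxb hyc h).elim
  refine ⟨isPath_append hpq.1.of_append_left hqr.1 fun x hx hx' => ?_, fun x hx y hy h => ?_⟩
  · rw [Walk.mem_support_append_iff] at hx'
    rcases hx' with hx' | hx'
    · by_contra hne
      rw [← Walk.cons_tail_support, List.mem_cons] at hx'
      exact hnd.2.2 hx (hx'.resolve_left hne)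
    · exact (hpr x hx hx').elim
  · have h1 := hpq.2 x
    have h2 := hqr.2 x
    simp only [Walk.mem_support_append_iff, Walk.edges_append, List.mem_append] at hx hy h1 h2 ⊢
    rcases hx with hx | hx | hx <;> rcases hy with hy | hy | hy
    · rcases h1 (.inl hx) y (.inl hy) h with h | h <;> simp [h]
    · rcases h1 (.inl hx) y (.inr hy) h with h | h <;> simp [h]
    · exact cross x hx y hy h
    · rcases h1 (.inr hx) y (.inl hy) h with h | h <;> simp [h]
    · rcases h1 (.inr hx) y (.inr hy) h with h | h <;> simp [h]
    · exact .inr (h2 (.inl hx) y (.inr hy) h)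
    · rw [Sym2.eq_swap]
      exact cross y hy x hx h.symm
    · exact .inr (h2 (.inr hx) y (.inl hy) h)
    · exact .inr (h2 (.inr hx) y (.inr hy) h)

lemma mem_support_cases {p : G.Walk a b} {x : V} (hx : x ∈ p.support) :
    x = a ∨ x = b ∨ x ∈ interiorL p := by
  rw [← Walk.cons_tail_support, List.mem_cons] at hx
  rcases hx with rfl | hx
  · exact .inl rfl
  refine .inr ?_
  have hne : p.support.tail ≠ [] := List.ne_nil_of_mem hx
  rw [← List.dropLast_append_getLast hne, List.mem_append, List.mem_singleton] at hx
  rcases hx with hx | rfl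
  · exact .inr hx
  · left
    rw [List.getLast_tail, Walk.getLast_support]

end Walks

section Girth

variable {G : SimpleGraph V} {a b : V} {n : ℕ}

lemma le_length_add_length (hg : G.egirth = n) {p q : G.Walk a b} (hp : p.IsPath)
    (hq : q.IsPath) (hne : p ≠ q) : n ≤ p.length + q.length := by
  obtain ⟨w, -, -, c, hc, hlen⟩ := hp.exists_isCycle_length_le_add_of_ne hq hne
  have := egirth_le_length hc
  rw [hg] at this
  exact (Nat.cast_le.1 this).trans hlen

lemma le_length_add_one (hg : G.egirth = n) (w : G.Walk a b) (h : G.Adj a b)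
    (he : s(a, b) ∉ w.edges) : n ≤ w.length + 1 := by
  classical
  have hne : w.bypass ≠ h.toWalk := by
    intro heq
    apply he
    apply w.edges_bypass_subset_edges
    simp [heq]
  have := le_length_add_length hg w.bypass_isPath (Walk.IsPath.of_adj h) hne
  have h2 := w.length_bypass_le_length
  simp at this
  omega

lemma not_adj_of_adj_of_mem_cycle (hg : G.egirth = n) (hn : 5 ≤ n) {v : V} {c : G.Walk v v}
    (hc : c.length = n) {x s t : V} (hx : x ∉ c.support) (hs : s ∈ c.support)
    (ht : t ∈ c.support) (hst : s ≠ t) (hxs : G.Adj x s) : ¬ G.Adj x t := by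
  classical
  intro hxt
  have key : ∀ w : G.Walk s t, x ∉ w.support → n ≤ w.length + 2 := by
    intro w hw
    have := le_length_add_one hg (w.append hxt.symm.toWalk) hxs.symm (by
      rw [Walk.edges_append, List.mem_append]
      rintro (h | h)
      · exact hw (w.snd_mem_support_of_mem_edges h)
      · simp [hst, hxs.ne'] at h)
    simpa using this
  set c' := c.rotate s hs
  have ht' : t ∈ c'.support := (c.mem_support_rotate_iff s hs).2 ht
  have hx' : x ∉ c'.support := fun h => hx ((c.mem_support_rotate_iff s hs).1 h)
  have h1 := key (c'.takeUntil t ht') fun h => hx' (c'.support_takeUntil_subset_support ht' h)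
  have h2 := key (c'.dropUntil t ht').reverse fun h =>
    hx' (c'.support_dropUntil_subset_support ht' (by simpa using h))
  have h3 := congrArg Walk.length (c'.take_spec ht')
  have h4 : c'.length = n := by simp [c', hc]
  simp only [Walk.length_append, Walk.length_reverse] at h2 h3
  omega

end Girth

section Critical

variable {G : SimpleGraph V}

lemma VertexCritical.not_three_coloring (h : VertexCritical 4 G) (f : V → Fin 3)
    (hf : ∀ x y, G.Adj x y → f x ≠ f y) : False := by
  have : G.Colorable 3 := ⟨Coloring.mk f fun {x y} => hf x y⟩
  have := chromaticNumber_le_iff_colorable.2 this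
  rw [h.1] at this
  exact absurd this (by decide)

lemma VertexCritical.exists_three_coloring_compl (h : VertexCritical 4 G) (v : V) :
    ∃ f : V → Fin 3, ∀ x y, x ≠ v → y ≠ v → G.Adj x y → f x ≠ f y := by
  classical
  have hlt := h.2 v
  have hle : (G.induce ({v}ᶜ : Set V)).chromaticNumber ≤ ((3 : ℕ) : ℕ∞) :=
    Order.le_of_lt_add_one (by exact_mod_cast hlt)
  obtain ⟨C⟩ := chromaticNumber_le_iff_colorable.1 hle
  refine ⟨fun x => if hx : x ∈ ({v}ᶜ : Set V) then C ⟨x, hx⟩ else 0, fun x y hx hy hxy => ?_⟩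
  have hx' : x ∈ ({v}ᶜ : Set V) := hx
  have hy' : y ∈ ({v}ᶜ : Set V) := hy
  simp only [hx', hy', dif_pos]
  exact C.valid (by simpa using hxy)

lemma VertexCritical.exists_adj_ne_ne (h : VertexCritical 4 G) (v a b : V) :
    ∃ k, G.Adj v k ∧ k ≠ a ∧ k ≠ b := by
  classical
  by_contra! hcon
  obtain ⟨f, hf⟩ := h.exists_three_coloring_compl v
  obtain ⟨c, hca, hcb⟩ : ∃ c : Fin 3, c ≠ f a ∧ c ≠ f b := by
    generalize f a = i
    generalize f b = j
    revert i j
    decide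
  have hc : ∀ k, G.Adj v k → c ≠ f k := fun k hk => by
    by_cases hka : k = a
    · rwa [hka]
    · rwa [hcon k hk hka]
  refine h.not_three_coloring (Function.update f v c) fun x y hxy => ?_
  by_cases hx : x = v
  · subst hx
    rw [Function.update_self, Function.update_of_ne hxy.ne']
    exact hc y hxy
  · by_cases hy : y = v
    · subst hy
      rw [Function.update_self, Function.update_of_ne hx]
      exact (hc x hxy.symm).symm
    · rw [Function.update_of_ne hx, Function.update_of_ne hy]
      exact hf x y hx hy hxy

lemma VertexCritical.not_edge_separates (h : VertexCritical 4 G) {K : Set V} {a b k z : V}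
    (hab : G.Adj a b) (ha : a ∉ K) (hb : b ∉ K) (hk : k ∈ K) (hz : z ∉ K) (hza : z ≠ a)
    (hzb : z ≠ b) (hK : ∀ v ∈ K, ∀ w, G.Adj v w → w ∈ K ∨ w = a ∨ w = b) : False := by
  classical
  obtain ⟨f, hf⟩ := h.exists_three_coloring_compl k
  obtain ⟨g, hg⟩ := h.exists_three_coloring_compl z
  have hne : ∀ {x y : V}, x ∈ K → y ∉ K → y ≠ x := fun hx hy e => hy (e ▸ hx)
  have hfab := hf a b (hne hk ha) (hne hk hb) hab
  have hgab := hg a b hza.symm hzb.symm hab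
  obtain ⟨σ, hσ, hσa, hσb⟩ : ∃ σ : Fin 3 → Fin 3, Function.Injective σ ∧
      σ (g a) = f a ∧ σ (g b) = f b := by
    generalize f a = i at *
    generalize f b = j at *
    generalize g a = i' at *
    generalize g b = j' at *
    clear hf hg
    revert i j i' j'
    decide
  have key : ∀ x y, x ∈ K → y ∉ K → G.Adj x y → σ (g x) ≠ f y := by
    intro x y hx hy hxy
    have hxz : x ≠ z := (hne hx hz).symm
    rcases hK x hx y hxy with h | rfl | rfl
    · exact (hy h).elim
    · rw [← hσa]
      exact hσ.ne (hg _ _ hxz hza.symm hxy)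
    · rw [← hσb]
      exact hσ.ne (hg _ _ hxz hzb.symm hxy)
  refine h.not_three_coloring (fun v => if v ∈ K then σ (g v) else f v) fun x y hxy => ?_
  by_cases hx : x ∈ K <;> by_cases hy : y ∈ K <;> simp only [hx, hy, if_true, if_false]
  · exact hσ.ne (hg _ _ (hne hx hz).symm (hne hy hz).symm hxy)
  · exact key x y hx hy hxy
  · exact (key y x hy hx hxy.symm).symm
  · exact hf _ _ (hne hk hx) (hne hk hy) hxy

end Critical

namespace OddK4

variable {G : SimpleGraph V} (K : OddK4 G)

lemma support_inter :
    (∀ x ∈ K.Q1.support, x ∈ K.L2.support → x = K.u2) ∧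
    (∀ x ∈ K.L1.support, x ∈ K.Q2.support → x = K.u1) ∧
    (∀ x ∈ K.P1.support, x ∈ K.L1.support → x = K.u1) ∧
    (∀ x ∈ K.P1.support, x ∈ K.L2.support → x = K.u2) ∧
    (∀ x ∈ K.P1.support, x ∈ K.Q1.support → x = K.u2) ∧
    (∀ x ∈ K.P1.support, x ∈ K.Q2.support → x = K.u1) ∧
    (∀ x ∈ K.L1.support, x ∈ K.Q1.support → x = K.u3) ∧
    (∀ x ∈ K.L2.support, x ∈ K.Q2.support → x = K.u4) ∧
    (∀ x ∈ K.P2.support, x ∈ K.Q1.support → x = K.u3) ∧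
    (∀ x ∈ K.P2.support, x ∈ K.L1.support → x = K.u3) ∧
    (∀ x ∈ K.P2.support, x ∈ K.Q2.support → x = K.u4) ∧
    (∀ x ∈ K.P2.support, x ∈ K.L2.support → x = K.u4) ∧
    (∀ x ∈ K.L1.support, x ∈ K.L2.support → False) ∧
    (∀ x ∈ K.Q1.support, x ∈ K.Q2.support → False) ∧
    (∀ x ∈ K.P1.support, x ∈ K.P2.support → False) := by
  have h1 := K.hnodup
  have h2 := K.hdisj
  have h3 := K.hbranch
  simp only [List.pairwise_cons, List.mem_cons, List.not_mem_nil, or_false, forall_eq_or_imp,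
    forall_eq, List.Disjoint, List.nodup_cons, not_or, List.mem_append] at h1 h2 h3
  obtain ⟨⟨a1, a2, a3, a4, a5⟩, ⟨b1, b2, b3, b4⟩, ⟨c1, c2, c3⟩, ⟨d1, d2⟩, e1, -⟩ := h2
  refine ⟨?_, ?_, ?_, ?_, ?_, ?_, ?_, ?_, ?_, ?_, ?_, ?_, ?_, ?_, ?_⟩ <;> intro x hx hy <;>
    rcases mem_support_cases hx with h | h | h <;>
    rcases mem_support_cases hy with h' | h' | h' <;> grind

end OddK4

section Walks

variable {G : SimpleGraph V} {a b c d : V} {n : ℕ}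

lemma not_adj_of_length_lt (hg : G.egirth = n) {A : G.Walk a b} {B : G.Walk c d}
    {R : G.Walk b c} {S : G.Walk a d} {x y : V} (hx : x ∈ A.support) (hy : y ∈ B.support)
    (hAB : ∀ z ∈ A.support, z ∈ B.support → False)
    (hlen : A.length + B.length + R.length + S.length + 2 < 2 * n)
    (hR : x ∈ R.support → y ∈ R.support → False)
    (hS : x ∈ S.support → y ∈ S.support → False) : ¬ G.Adj x y := by
  classical
  intro h
  have hA := fun he : s(x, y) ∈ A.edges => hAB y (A.snd_mem_support_of_mem_edges he) hy
  have hB := fun he : s(x, y) ∈ B.edges => hAB x hx (B.fst_mem_support_of_mem_edges he)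
  have hR' := fun he : s(x, y) ∈ R.edges =>
    hR (R.fst_mem_support_of_mem_edges he) (R.snd_mem_support_of_mem_edges he)
  have hS' := fun he : s(x, y) ∈ S.edges =>
    hS (S.fst_mem_support_of_mem_edges he) (S.snd_mem_support_of_mem_edges he)
  have h1 := le_length_add_one hg ((A.dropUntil x hx).append (R.append (B.takeUntil y hy))) h (by
    simp only [Walk.edges_append, List.mem_append]
    rintro (he | he | he)
    · exact hA (A.edges_dropUntil_subset_edges hx he)
    · exact hR' he
    · exact hB (B.edges_takeUntil_subset_edges hy he))
  have h2 := le_length_add_one hg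
    ((A.takeUntil x hx).reverse.append (S.append (B.dropUntil y hy).reverse)) h (by
    simp only [Walk.edges_append, Walk.edges_reverse, List.mem_append, List.mem_reverse]
    rintro (he | he | he)
    · exact hA (A.edges_takeUntil_subset_edges hx he)
    · exact hS' he
    · exact hB (B.edges_dropUntil_subset_edges hy he))
  have h3 := congrArg Walk.length (A.take_spec hx)
  have h4 := congrArg Walk.length (B.take_spec hy)
  simp only [Walk.length_append, Walk.length_reverse] at h1 h2 h3 h4
  omega

end Walks

namespace OddK4

variable {G : SimpleGraph V} (K : OddK4 G) {ℓ : ℕ}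

lemma length_eq (hG : InGFamily ℓ G) :
    K.P1.length = K.P2.length ∧ K.Q1.length = K.Q2.length ∧ K.L1.length = K.L2.length ∧
      K.P2.length + K.Q1.length + K.L2.length = 2 * ℓ + 1 := by
  have h1 := hG.2 _ _ K.face1
  have h2 := hG.2 _ _ K.face2
  have h3 := hG.2 _ _ K.face3
  have h4 := hG.2 _ _ K.face4
  simp only [Walk.length_append, Walk.length_reverse] at h1 h2 h3 h4
  omega

lemma ne : K.u1 ≠ K.u2 ∧ K.u1 ≠ K.u3 ∧ K.u1 ≠ K.u4 ∧ K.u2 ≠ K.u3 ∧ K.u2 ≠ K.u4 ∧ K.u3 ≠ K.u4 := by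
  have := K.hnodup
  simp at this
  tauto

lemma length_P2_le (hG : InGFamily ℓ G) : K.P2.length ≤ ℓ := by
  obtain ⟨i1, i2, -, -, -, -, i7, i8, -, -, -, -, iL, -⟩ := K.support_inter
  obtain ⟨e1, e2, e3, e4⟩ := K.length_eq hG
  have h0 : (K.Q1.reverse.append K.L2).IsPath :=
    isPath_append K.hQ1.reverse K.hL2 fun x hx hx' => i1 x (by simpa using hx) hx'
  have h1 : (K.L1.reverse.append K.Q2).IsPath :=
    isPath_append K.hL1.reverse K.hQ2 fun x hx hx' => i2 x (by simpa using hx) hx'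
  have := le_length_add_length hG.1 h0 h1 (by
    intro h
    have hu : K.u2 ∈ (K.L1.reverse.append K.Q2).support := by
      rw [← h]
      simp
    simp only [Walk.mem_support_append_iff, Walk.support_reverse, List.mem_reverse] at hu
    rcases hu with hu | hu
    · exact iL _ hu K.L2.start_mem_support
    · exact K.ne.2.2.2.2.1 (i8 _ K.L2.start_mem_support hu))
  simp only [Walk.length_append, Walk.length_reverse] at this
  omega

lemma not_adj (hG : InGFamily ℓ G) (h2 : 2 ≤ K.P2.length) : ¬ G.Adj K.u3 K.u4 := by
  intro h
  have h0 := le_length_add_length hG.1 K.hP2 (Walk.IsPath.of_adj h) (by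
    intro h'
    simp [h'] at h2)
  have := K.length_P2_le hG
  simp at h0
  omega

/-- The vertices on the arrises other than `P2`. -/
def outer : Set V :=
  {x | x ∈ K.P1.support ∨ x ∈ K.Q1.support ∨ x ∈ K.Q2.support ∨ x ∈ K.L1.support ∨
    x ∈ K.L2.support}

lemma isInducedPath_Q1_L2 (h2 : 2 ≤ K.P2.length) :
    IsInducedPath G (K.Q1.reverse.append K.L2) := by
  obtain ⟨i1, i2, i3, i4, i5, i6, i7, i8, i9, i10, i11, i12, iL, iQ, iP⟩ := K.support_inter
  refine K.face4.1.isInducedPath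
    (isPath_append K.hQ1.reverse K.hL2 fun x hx hx' => i1 x (by simpa using hx) hx')
    K.hP2 h2 (fun x hx => ?_) (fun e he => ?_) fun x hx hx' => ?_
  · simp at hx ⊢
    tauto
  · simp at he ⊢
    tauto
  · simp at hx
    rcases hx with hx | hx
    · exact .inl (i9 x hx' hx)
    · exact .inr (i12 x hx' hx)

lemma isInducedPath_L1_P1 (h2 : 2 ≤ K.Q1.length) :
    IsInducedPath G (K.L1.reverse.append K.P1) := by
  obtain ⟨i1, i2, i3, i4, i5, i6, i7, i8, i9, i10, i11, i12, iL, iQ, iP⟩ := K.support_inter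
  refine K.face1.1.isInducedPath (z := K.Q1.reverse)
    (isPath_append K.hL1.reverse K.hP1 fun x hx hx' => i3 x hx' (by simpa using hx))
    K.hQ1.reverse (by simpa) (fun x hx => ?_) (fun e he => ?_) fun x hx hx' => ?_
  · simp at hx ⊢
    tauto
  · simp at he ⊢
    tauto
  · simp at hx hx'
    rcases hx with hx | hx
    · exact .inl (i7 x hx hx')
    · exact .inr (i5 x hx hx')

lemma isInducedPath_Q1_P1 (h2 : 2 ≤ K.L1.length) :
    IsInducedPath G (K.Q1.reverse.append K.P1.reverse) := by
  obtain ⟨i1, i2, i3, i4, i5, i6, i7, i8, i9, i10, i11, i12, iL, iQ, iP⟩ := K.support_inter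
  refine K.face1.1.isInducedPath (z := K.L1.reverse)
    (isPath_append K.hQ1.reverse K.hP1.reverse fun x hx hx' =>
      i5 x (by simpa using hx') (by simpa using hx))
    K.hL1.reverse (by simpa) (fun x hx => ?_) (fun e he => ?_) fun x hx hx' => ?_
  · simp at hx ⊢
    tauto
  · simp at he ⊢
    tauto
  · simp at hx hx'
    rcases hx with hx | hx
    · exact .inl (i7 x hx' hx)
    · exact .inr (i3 x hx hx')

lemma isInducedPath_P1_L2 (h2 : 2 ≤ K.Q2.length) :
    IsInducedPath G (K.P1.append K.L2) := by
  obtain ⟨i1, i2, i3, i4, i5, i6, i7, i8, i9, i10, i11, i12, iL, iQ, iP⟩ := K.support_inter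
  refine K.face2.1.isInducedPath (isPath_append K.hP1 K.hL2 i4)
    K.hQ2 h2 (fun x hx => ?_) (fun e he => ?_) fun x hx hx' => ?_
  · simp at hx ⊢
    tauto
  · simp at he ⊢
    tauto
  · simp at hx
    rcases hx with hx | hx
    · exact .inl (i6 x hx hx')
    · exact .inr (i8 x hx hx')

lemma isInducedPath_P1_Q2 (h2 : 2 ≤ K.L2.length) :
    IsInducedPath G (K.P1.reverse.append K.Q2) := by
  obtain ⟨i1, i2, i3, i4, i5, i6, i7, i8, i9, i10, i11, i12, iL, iQ, iP⟩ := K.support_inter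
  refine K.face2.1.isInducedPath
    (isPath_append K.hP1.reverse K.hQ2 fun x hx hx' => i6 x (by simpa using hx) hx')
    K.hL2 h2 (fun x hx => ?_) (fun e he => ?_) fun x hx hx' => ?_
  · simp at hx ⊢
    tauto
  · simp at he ⊢
    tauto
  · simp at hx
    rcases hx with hx | hx
    · exact .inl (i4 x hx hx')
    · exact .inr (i8 x hx' hx)

lemma isInducedPath_L1_P1_L2 (hG : InGFamily ℓ G) (hP : 2 ≤ K.P2.length) (h2 : 2 ≤ K.Q1.length) :
    IsInducedPath G (K.L1.reverse.append (K.P1.append K.L2)) := by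
  obtain ⟨i1, i2, i3, i4, i5, i6, i7, i8, i9, i10, i11, i12, iL, iQ, iP⟩ := K.support_inter
  obtain ⟨e1, e2, e3, e4⟩ := K.length_eq hG
  refine isInducedPath_append_append (K.isInducedPath_L1_P1 h2)
    (K.isInducedPath_P1_L2 (e2 ▸ h2)) (fun x hx hx' => iL x (by simpa using hx) hx') ?_
  intro x hx y hy hx1 hy2
  simp only [Walk.support_reverse, List.mem_reverse] at hx
  refine not_adj_of_length_lt (R := K.Q1.reverse) (S := K.Q2) hG.1 hx hy iL
    (by simp only [Walk.length_reverse]; omega) (fun _ h => ?_) fun h _ => hx1 (i2 x hx h)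
  exact hy2 (i1 y (by simpa using h) hy)

lemma isInducedPath_Q1_P1_Q2 (hG : InGFamily ℓ G) (hP : 2 ≤ K.P2.length) (h2 : 2 ≤ K.L1.length) :
    IsInducedPath G (K.Q1.reverse.append (K.P1.reverse.append K.Q2)) := by
  obtain ⟨i1, i2, i3, i4, i5, i6, i7, i8, i9, i10, i11, i12, iL, iQ, iP⟩ := K.support_inter
  obtain ⟨e1, e2, e3, e4⟩ := K.length_eq hG
  refine isInducedPath_append_append (K.isInducedPath_Q1_P1 h2)
    (K.isInducedPath_P1_Q2 (e3 ▸ h2)) (fun x hx hx' => iQ x (by simpa using hx) hx') ?_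
  intro x hx y hy hx1 hy2
  simp only [Walk.support_reverse, List.mem_reverse] at hx
  refine not_adj_of_length_lt (R := K.L1.reverse) (S := K.L2) hG.1 hx hy iQ
    (by simp only [Walk.length_reverse]; omega) (fun _ h => ?_) fun h _ => hx1 (i1 x hx h)
  exact hy2 (i2 y (by simpa using h) hy)

lemma length_add_length_eq (hG : InGFamily ℓ G) (hP : 2 ≤ K.P2.length)
    {p T : G.Walk K.u3 K.u4} (hp : IsInducedPath G p) (hT : IsInducedPath G T)
    (hTo : ∀ x ∈ T.support, x ∈ K.outer)
    (hpo : ∀ x ∈ p.support, x = K.u3 ∨ x = K.u4 ∨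
      x ∉ K.outer ∧ ∀ y ∈ K.outer, y ≠ K.u3 → y ≠ K.u4 → ¬ G.Adj x y)
    (hodd : Odd (p.length + T.length)) : p.length + T.length = 2 * ℓ + 1 := by
  have hhole := isHole_append_reverse hp hT K.ne.2.2.2.2.2 (K.not_adj hG hP)
    (fun x hx hx' => by
      rcases hpo x hx with h | h | h
      · exact .inl h
      · exact .inr h
      · exact (h.1 (hTo x hx')).elim)
    (fun x hx y hy hxy => by
      rcases hpo x hx with h | h | h
      · exact .inl h
      · exact .inr (.inl h)
      · by_contra! hne
        exact h.2 y (hTo y hy) hne.2.2.1 hne.2.2.2 hxy)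
  have := hG.2 _ _ ⟨hhole, by simpa using hodd⟩
  simpa using this

lemma length_eq_length_P2 (hG : InGFamily ℓ G) (hP : 2 ≤ K.P2.length) (hlong : K.longestPair)
    {p : G.Walk K.u3 K.u4} (hp : IsInducedPath G p)
    (hpo : ∀ x ∈ p.support, x = K.u3 ∨ x = K.u4 ∨
      x ∉ K.outer ∧ ∀ y ∈ K.outer, y ≠ K.u3 → y ≠ K.u4 → ¬ G.Adj x y) :
    p.length = K.P2.length := by
  obtain ⟨e1, e2, e3, e4⟩ := K.length_eq hG
  have hle := K.length_P2_le hG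
  obtain ⟨l1, -, l3, -⟩ := hlong
  have hT0 := K.isInducedPath_Q1_L2 hP
  have h0 := K.length_add_length_eq hG hP hp hT0 (fun x hx => by
    simp at hx
    simp only [outer, Set.mem_ofPred_eq]
    tauto) hpo
  by_cases hpar : Odd (p.length + (K.Q1.reverse.append K.L2).length)
  · have := h0 hpar
    simp only [Walk.length_append, Walk.length_reverse] at this
    omega
  exfalso
  have hgirth : 2 * ℓ + 1 ≤ p.length + (K.Q1.reverse.append K.L2).length := by
    refine le_length_add_length hG.1 hp.1 hT0.1 ?_
    rintro rfl
    rcases hpo K.u2 (by simp) with h | h | h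
    · exact K.ne.2.2.2.1 h
    · exact K.ne.2.2.2.2.1 h
    · exact h.1 (.inl K.P1.end_mem_support)
  simp only [Walk.length_append, Walk.length_reverse, Nat.odd_iff] at hpar hgirth
  rcases (show 2 ≤ K.Q1.length ∨ 2 ≤ K.L1.length by omega) with h2 | h2
  · have := K.length_add_length_eq hG hP hp (K.isInducedPath_L1_P1_L2 hG hP h2) (fun x hx => by
      simp at hx
      simp only [outer, Set.mem_ofPred_eq]
      tauto) hpo (by
      simp only [Walk.length_append, Walk.length_reverse, Nat.odd_iff]
      omega)
    simp only [Walk.length_append, Walk.length_reverse] at this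
    omega
  · have := K.length_add_length_eq hG hP hp (K.isInducedPath_Q1_P1_Q2 hG hP h2) (fun x hx => by
      simp at hx
      simp only [outer, Set.mem_ofPred_eq]
      tauto) hpo (by
      simp only [Walk.length_append, Walk.length_reverse, Nat.odd_iff]
      omega)
    simp only [Walk.length_append, Walk.length_reverse] at this
    omega

end OddK4

section Cuts

variable {G : SimpleGraph V} {X D : Set V}

lemma exists_component_of_minimal_cut (hcut : IsVertexCut G X)
    (hmincut : ∀ X' ⊆ X, IsVertexCut G X' → X' = X) {u : V} (hu : u ∉ X) :
    ∃ D : Set V, u ∉ D ∧ (∀ v ∈ D, v ∉ X) ∧ (∀ v ∈ D, ∀ w, G.Adj v w → w ∈ D ∨ w ∈ X) ∧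
      (∀ a ∈ D, ∀ b ∈ D, ∃ w : G.Walk a b, ∀ x ∈ w.support, x ∈ D) ∧
      ∀ x ∈ X, ∃ v ∈ D, G.Adj x v := by
  classical
  obtain ⟨d, hd, hdu⟩ : ∃ d, ∃ hd : d ∈ Xᶜ, ¬ (G.induce Xᶜ).Reachable ⟨d, hd⟩ ⟨u, hu⟩ := by
    by_contra! h
    exact hcut fun a b => (h a.1 a.2).trans (h b.1 b.2).symm
  set D : Set V := {v | ∃ w : G.Walk d v, ∀ x ∈ w.support, x ∉ X} with hD
  have hdD : d ∈ D := ⟨.nil, by simpa using hd⟩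
  have huD : u ∉ D := fun ⟨w, hw⟩ => hdu (w.induce Xᶜ hw).reachable
  have hDX : ∀ v ∈ D, v ∉ X := fun v ⟨w, hw⟩ => hw v w.end_mem_support
  have hclosed : ∀ v ∈ D, ∀ w, G.Adj v w → w ∈ D ∨ w ∈ X := by
    rintro v ⟨p, hp⟩ w hvw
    by_cases hw : w ∈ X
    · exact .inr hw
    refine .inl ⟨p.concat hvw, fun x hx => ?_⟩
    rw [Walk.support_concat, List.mem_append, List.mem_singleton] at hx
    rcases hx with hx | rfl
    · exact hp x hx
    · exact hw
  refine ⟨D, huD, hDX, hclosed, ?_, fun x hx => ?_⟩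
  · have hsupp : ∀ v (w : G.Walk d v), (∀ x ∈ w.support, x ∉ X) → ∀ x ∈ w.support, x ∈ D :=
      fun v w hw x hx =>
        ⟨w.takeUntil x hx, fun y hy => hw y (w.support_takeUntil_subset_support hx hy)⟩
    rintro a ⟨p, hp⟩ b ⟨q, hq⟩
    refine ⟨p.reverse.append q, fun x hx => ?_⟩
    simp only [Walk.mem_support_append_iff, Walk.support_reverse, List.mem_reverse] at hx
    exact hx.elim (hsupp _ p hp x) (hsupp _ q hq x)
  · have hpre : (G.induce (X \ {x})ᶜ).Preconnected := by
      by_contra h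
      have := hmincut _ Set.sdiff_subset h
      rw [← this] at hx
      exact hx.2 rfl
    have hsub : Xᶜ ⊆ (X \ {x})ᶜ := Set.compl_subset_compl.2 Set.sdiff_subset
    obtain ⟨w⟩ := hpre ⟨d, hsub hd⟩ ⟨u, hsub hu⟩
    obtain ⟨e, -, he1, he2⟩ := w.exists_boundary_dart {v | v.1 ∈ D} hdD huD
    have hadj : G.Adj e.fst.1 e.snd.1 := e.adj
    have hX := (hclosed _ he1 _ hadj).resolve_left he2
    have hx : e.snd.1 = x := by
      by_contra hne
      exact e.snd.2 ⟨hX, hne⟩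
    rw [hx] at hadj
    exact ⟨e.fst.1, he1, hadj.symm⟩

lemma VertexCritical.not_all_induced_paths_short (hcrit : VertexCritical 4 G) {n m : ℕ}
    (hg : G.egirth = n) (hm : 4 ≤ m) (hmn : 2 * m < n) {a b : V} (ha : a ∈ X) (hb : b ∈ X)
    (hXN : X ⊆ closedNbhd G {a, b})
    (hclosed : ∀ v ∈ D, ∀ w, G.Adj v w → w ∈ D ∨ w ∈ X)
    (hconn : ∀ a ∈ D, ∀ b ∈ D, ∃ w : G.Walk a b, ∀ x ∈ w.support, x ∈ D)
    (hfull : ∀ x ∈ X, ∃ v ∈ D, G.Adj x v)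
    (hpaths : ∀ p : G.Walk a b, IsInducedPath G p → (∀ x ∈ p.support, x ∈ X ∪ D) →
      p.length = m) : False := by
  classical
  obtain ⟨p, hp, hpD⟩ : ∃ p : G.Walk a b, IsInducedPath G p ∧ ∀ x ∈ p.support, x ∈ X ∪ D := by
    obtain ⟨v, hv, hav⟩ := hfull a ha
    obtain ⟨w, hw, hbw⟩ := hfull b hb
    obtain ⟨q, hq⟩ := hconn v hv w hw
    obtain ⟨p, hp, hps⟩ := exists_isInducedPath_support_subset (.cons hav (q.concat hbw.symm))
    refine ⟨p, hp, fun x hx => ?_⟩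
    have := hps hx
    simp only [Walk.support_cons, Walk.support_concat, List.mem_cons,
      List.mem_append, List.not_mem_nil, or_false] at this
    rcases this with rfl | h | rfl
    · exact .inl ha
    · exact .inr (hq x h)
    · exact .inl hb
  have hlen := hpaths p hp hpD
  have hinj : ∀ i j, i ≤ m → j ≤ m → p.getVert i = p.getVert j → i = j :=
    fun i j hi hj h => hp.1.getVert_injOn (hlen ▸ hi) (hlen ▸ hj) h
  have hp0 : p.getVert 0 = a := p.getVert_zero
  have hpm : p.getVert m = b := hlen ▸ p.getVert_length
  have hcover : ∀ w : G.Walk a b, (∀ x ∈ w.support, x ∈ X ∪ D) → p.support ⊆ w.support := by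
    intro w hw
    obtain ⟨q, hq, hqs⟩ := exists_isInducedPath_support_subset w
    have hqm := hpaths q hq fun x hx => hw x (hqs hx)
    by_cases h : p = q
    · rwa [h]
    · have := le_length_add_length hg hp.1 hq.1 h
      omega
  have hXadj : ∀ x ∈ X, x ∉ p.support → G.Adj x (p.getVert 0) ∨ G.Adj x (p.getVert m) := by
    intro x hx hxp
    rw [hp0, hpm]
    rcases hXN hx with (rfl | rfl) | ⟨u, rfl | rfl, hu⟩
    · exact (hxp p.start_mem_support).elim
    · exact (hxp p.end_mem_support).elim
    · exact .inl hu.symm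
    · exact .inr hu.symm
  have h2D : p.getVert 2 ∈ D := by
    refine (hpD _ (p.getVert_mem_support 2)).resolve_left fun h => ?_
    have hadj0 : ¬ G.Adj (p.getVert 0) (p.getVert 2) := fun h => by
      have := hp.eq_add_one_of_adj (by omega) (by omega) h
      omega
    have hadjm : ¬ G.Adj (p.getVert m) (p.getVert 2) := fun h => by
      have := hp.eq_add_one_of_adj (by omega) (by omega) h
      omega
    rcases hXN h with (h | h) | ⟨u, rfl | rfl, hu⟩
    · have := hinj 2 0 (by omega) (by omega) (h.trans hp0.symm)
      omega
    · have := hinj 2 m (by omega) (by omega) (h.trans hpm.symm)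
      omega
    · exact hadj0 (hp0.symm ▸ hu)
    · exact hadjm (hpm.symm ▸ hu)
  obtain ⟨k, hk, hk1, hk3⟩ := hcrit.exists_adj_ne_ne (p.getVert 2) (p.getVert 1) (p.getVert 3)
  have hkp : k ∉ p.support := by
    intro h
    obtain ⟨i, rfl, hi⟩ := Walk.mem_support_iff_exists_getVert.1 h
    rcases hp.eq_add_one_of_adj (by omega) hi hk with h | h
    · obtain rfl : i = 1 := by omega
      exact hk1 rfl
    · obtain rfl : i = 3 := by omega
      exact hk3 rfl
  set C : Set V := {v | ∃ w : G.Walk k v, ∀ x ∈ w.support, x ∈ X ∪ D ∧ x ∉ p.support} with hC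
  have hkC : k ∈ C := by
    refine ⟨.nil, fun x hx => ?_⟩
    obtain rfl : x = k := by simpa using hx
    exact ⟨(hclosed _ h2D _ hk).symm, hkp⟩
  have hCp : ∀ v ∈ C, v ∈ X ∪ D ∧ v ∉ p.support := fun v ⟨w, hw⟩ => hw v w.end_mem_support
  have hnear : ∀ v ∈ C, ∀ v' ∈ C, ∀ i j, j ≤ m → G.Adj v (p.getVert i) →
      G.Adj v' (p.getVert j) → j ≤ i + 1 := by
    rintro v ⟨w, hw⟩ v' ⟨w', hw'⟩ i j hj hi hj'
    by_contra! hij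
    have := hcover ((p.take i).append (.cons hi.symm
        ((w.reverse.append w').append (.cons hj' (p.drop j))))) (fun x hx => ?_)
      (p.getVert_mem_support (i + 1))
    · simp only [Walk.mem_support_append_iff, Walk.support_cons, List.mem_cons,
        Walk.support_reverse, List.mem_reverse] at this
      rcases this with h | h | (h | h) | h | h
      · obtain ⟨r, hr, -⟩ := Walk.mem_support_iff_exists_getVert.1 h
        rw [Walk.take_getVert] at hr
        have := hinj _ _ (by omega) (by omega) hr
        omega
      · have := hinj _ _ (by omega) (by omega) h
        omega
      · exact (hw _ h).2 (p.getVert_mem_support _)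
      · exact (hw' _ h).2 (p.getVert_mem_support _)
      · exact (hw' _ w'.end_mem_support).2 (h ▸ p.getVert_mem_support _)
      · obtain ⟨r, hr, hr'⟩ := Walk.mem_support_iff_exists_getVert.1 h
        rw [Walk.drop_getVert] at hr
        rw [Walk.drop_length] at hr'
        have := hinj _ _ (by omega) (by omega) hr
        omega
    · simp only [Walk.mem_support_append_iff, Walk.support_cons, List.mem_cons,
        Walk.support_reverse, List.mem_reverse] at hx
      rcases hx with h | rfl | (h | h) | rfl | h
      · exact hpD _ ((p.isSubwalk_take i).support_subset h)
      · exact hpD _ (p.getVert_mem_support i)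
      · exact (hw _ h).1
      · exact (hw' _ h).1
      · exact (hw' _ w'.end_mem_support).1
      · exact hpD _ ((p.isSubwalk_drop j).support_subset h)
  have hCX : ∀ v ∈ C, v ∉ X := by
    intro v hv hvX
    rcases hXadj v hvX (hCp v hv).2 with h | h
    · have := hnear v hv k hkC 0 2 (by omega) h hk.symm
      omega
    · have := hnear k hkC v hv 2 m le_rfl hk.symm h
      omega
  have hstep : ∀ v ∈ C, ∀ w, G.Adj v w → w ∈ C ∨ ∃ i ≤ m, w = p.getVert i := by
    rintro v hv w hvw
    by_cases hwp : w ∈ p.support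
    · obtain ⟨i, rfl, hi⟩ := Walk.mem_support_iff_exists_getVert.1 hwp
      exact .inr ⟨i, hlen ▸ hi, rfl⟩
    left
    have hvD := (hCp v hv).1.resolve_left (hCX v hv)
    obtain ⟨q, hq⟩ := hv
    refine ⟨q.concat hvw, fun x hx => ?_⟩
    rw [Walk.support_concat, List.mem_append, List.mem_singleton] at hx
    rcases hx with hx | rfl
    · exact hq x hx
    · exact ⟨(hclosed v hvD _ hvw).symm, hwp⟩
  obtain ⟨i, hi1, hi2, hi⟩ : ∃ i, 1 ≤ i ∧ i ≤ 2 ∧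
      ∀ v ∈ C, ∀ j ≤ m, G.Adj v (p.getVert j) → j = i ∨ j = i + 1 := by
    by_cases h : ∃ v ∈ C, G.Adj v (p.getVert 1)
    · obtain ⟨v, hv, hv1⟩ := h
      refine ⟨1, by omega, by omega, fun v' hv' j hj hj' => ?_⟩
      have := hnear v hv v' hv' 1 j hj hv1 hj'
      have := hnear v' hv' k hkC j 2 (by omega) hj' hk.symm
      omega
    · push Not at h
      refine ⟨2, by omega, by omega, fun v' hv' j hj hj' => ?_⟩
      have := hnear k hkC v' hv' 2 j hj hk.symm hj'
      have := hnear v' hv' k hkC j 2 (by omega) hj' hk.symm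
      have : j ≠ 1 := by
        rintro rfl
        exact h v' hv' hj'
      omega
  have hnot : ∀ j, p.getVert j ∉ C := fun j h => (hCp _ h).2 (p.getVert_mem_support j)
  refine hcrit.not_edge_separates (p.adj_getVert_succ (i := i) (by omega)) (hnot i) (hnot (i + 1))
    hkC (hnot 0) (fun h => ?_) (fun h => ?_) fun v hv w hvw => ?_
  · have := hinj _ _ (by omega) (by omega) h
    omega
  · have := hinj _ _ (by omega) (by omega) h
    omega
  · rcases hstep v hv w hvw with h | ⟨j, hj, rfl⟩
    · exact .inl h
    · rcases hi v hv j hj hvw with rfl | rfl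
      · exact .inr (.inl rfl)
      · exact .inr (.inr rfl)

end Cuts

namespace OddK4

variable {G : SimpleGraph V} (K : OddK4 G) {ℓ : ℕ}

lemma outer_subset_verts : K.outer ⊆ K.verts := by
  rintro x (h | h | h | h | h) <;> simp [verts, toSubgraph, h]

lemma not_adj_of_mem_outer (hG : InGFamily ℓ G) (hℓ : 2 ≤ ℓ) {x s y : V}
    (hx : x ∉ K.verts) (hs : s = K.u3 ∨ s = K.u4) (hxs : G.Adj x s) (hy : y ∈ K.outer)
    (hys : y ≠ s) : ¬ G.Adj x y := by
  have key : ∀ {v : V} {c : G.Walk v v}, IsOddHole G c → (∀ z ∈ c.support, z ∈ K.verts) →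
      s ∈ c.support → y ∈ c.support → ¬ G.Adj x y := fun hc hcK hsc hyc =>
    not_adj_of_adj_of_mem_cycle hG.1 (by omega) (hG.2 _ _ hc) (fun h => hx (hcK _ h)) hsc hyc
      hys.symm hxs
  have hverts : ∀ z, z ∈ K.verts ↔ z ∈ K.P1.support ∨ z ∈ K.P2.support ∨ z ∈ K.Q1.support ∨
      z ∈ K.Q2.support ∨ z ∈ K.L1.support ∨ z ∈ K.L2.support := by
    simp [verts, toSubgraph, or_assoc]
  have h1 := key K.face1 fun z hz => by
    simp only [Walk.mem_support_append_iff, Walk.support_reverse, List.mem_reverse] at hz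
    rw [hverts]
    rcases hz with h | h | h <;> simp [h]
  have h2 := key K.face2 fun z hz => by
    simp only [Walk.mem_support_append_iff, Walk.support_reverse, List.mem_reverse] at hz
    rw [hverts]
    rcases hz with h | h | h <;> simp [h]
  have h3 := key K.face3 fun z hz => by
    simp only [Walk.mem_support_append_iff, Walk.support_reverse, List.mem_reverse] at hz
    rw [hverts]
    rcases hz with h | h | h <;> simp [h]
  have h4 := key K.face4 fun z hz => by
    simp only [Walk.mem_support_append_iff, Walk.support_reverse, List.mem_reverse] at hz
    rw [hverts]
    rcases hz with h | h | h <;> simp [h]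
  simp only [Walk.mem_support_append_iff, Walk.support_reverse, List.mem_reverse] at h1 h2 h3 h4
  have hQ1 := K.Q1.end_mem_support
  have hQ2 := K.Q2.end_mem_support
  have hL1 := K.L1.end_mem_support
  have hL2 := K.L2.end_mem_support
  rcases hs with rfl | rfl <;> rcases hy with hy | hy | hy | hy | hy
  · exact h1 (.inr (.inl hQ1)) (.inl hy)
  · exact h1 (.inr (.inl hQ1)) (.inr (.inl hy))
  · exact h3 (.inl hL1) (.inr (.inr hy))
  · exact h1 (.inr (.inl hQ1)) (.inr (.inr hy))
  · exact h4 (.inl hQ1) (.inr (.inr hy))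
  · exact h2 (.inr (.inl hL2)) (.inl hy)
  · exact h4 (.inr (.inr hL2)) (.inl hy)
  · exact h2 (.inr (.inl hL2)) (.inr (.inr hy))
  · exact h3 (.inr (.inr hQ2)) (.inl hy)
  · exact h2 (.inr (.inl hL2)) (.inr (.inl hy))

lemma outer_disjoint {X D : Set V} (hXo : ∀ x ∈ K.outer, x ≠ K.u3 → x ≠ K.u4 → x ∉ X)
    (hDX : ∀ v ∈ D, v ∉ X) (hclosed : ∀ v ∈ D, ∀ w, G.Adj v w → w ∈ D ∨ w ∈ X)
    (h1 : K.u1 ∉ D) : ∀ x ∈ K.outer, x ∉ D := by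
  classical
  have key : ∀ {b c : V} (w : G.Walk b c), w.IsPath → b ∉ D →
      (∀ z ∈ w.support, z ∈ K.outer) → (∀ z ∈ w.support, z ∈ X → z = c) →
      ∀ x ∈ w.support, x ∉ D := by
    intro b c w hw hb hwo hwX x hx hxD
    obtain ⟨e, he, he1, he2⟩ := (w.takeUntil x hx).exists_boundary_dart Dᶜ hb (by simpa)
    have hfst := (w.takeUntil x hx).dart_fst_mem_support_of_mem_darts he
    have heD : e.snd ∈ D := by simpa using he2
    have hfX := (hclosed _ heD _ e.adj.symm).resolve_left he1
    have hfc := hwX _ (w.support_takeUntil_subset_support hx hfst) hfX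
    have hxc : x ≠ c := by
      rintro rfl
      exact hDX x hxD (hfc ▸ hfX)
    exact Walk.endpoint_notMem_support_takeUntil hw hx hxc.symm (hfc ▸ hfst)
  obtain ⟨i1, i2, i3, i4, -⟩ := K.support_inter
  obtain ⟨-, n13, n14, n23, n24, -⟩ := K.ne
  have hX : ∀ x ∈ K.outer, x ∈ X → x = K.u3 ∨ x = K.u4 := fun x hx hxX => by
    by_contra! h
    exact hXo x hx h.1 h.2 hxX
  have hP1 : ∀ x ∈ K.P1.support, x ∉ D := by
    refine key _ K.hP1 h1 (fun z hz => .inl hz) fun z hz hzX => ?_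
    rcases hX z (.inl hz) hzX with rfl | rfl
    · exact (n13 (i3 _ hz K.L1.end_mem_support).symm).elim
    · exact (n24 (i4 _ hz K.L2.end_mem_support).symm).elim
  have h2 := hP1 _ K.P1.end_mem_support
  have hQ1 : ∀ x ∈ K.Q1.support, x ∉ D := by
    refine key _ K.hQ1 h2 (fun z hz => .inr (.inl hz)) fun z hz hzX => ?_
    rcases hX z (.inr (.inl hz)) hzX with rfl | rfl
    · rfl
    · exact (n24 (i1 _ hz K.L2.end_mem_support).symm).elim
  have hQ2 : ∀ x ∈ K.Q2.support, x ∉ D := by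
    refine key _ K.hQ2 h1 (fun z hz => .inr (.inr (.inl hz))) fun z hz hzX => ?_
    rcases hX z (.inr (.inr (.inl hz))) hzX with rfl | rfl
    · exact (n13 (i2 _ K.L1.end_mem_support hz).symm).elim
    · rfl
  have hL1 : ∀ x ∈ K.L1.support, x ∉ D := by
    refine key _ K.hL1 h1 (fun z hz => .inr (.inr (.inr (.inl hz)))) fun z hz hzX => ?_
    rcases hX z (.inr (.inr (.inr (.inl hz)))) hzX with rfl | rfl
    · rfl
    · exact (n14 (i2 _ hz K.Q2.end_mem_support).symm).elim
  have hL2 : ∀ x ∈ K.L2.support, x ∉ D := by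
    refine key _ K.hL2 h2 (fun z hz => .inr (.inr (.inr (.inr hz)))) fun z hz hzX => ?_
    rcases hX z (.inr (.inr (.inr (.inr hz)))) hzX with rfl | rfl
    · exact (n23 (i1 _ K.Q1.end_mem_support hz).symm).elim
    · rfl
  rintro x (hx | hx | hx | hx | hx)
  exacts [hP1 x hx, hQ1 x hx, hQ2 x hx, hL1 x hx, hL2 x hx]

end OddK4

/-- in the setup of the proof of Theorem 1.2, let `X` be a minimal
vertex cut with `{u3, u4} ⊆ X ⊆ N[{u3, u4}]` and `X ∩ V(H) = {u3, u4}`, and let `G1`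
be the subgraph induced on `X` together with the component of `G − X` containing the
interior of `P2`. Then every induced `(u3, u4)`-path in `G1` has length `|P2|`. -/
theorem induced_paths_in_G1 {V : Type*}
    (ℓ : ℕ) (hℓ : 5 ≤ ℓ) (G : SimpleGraph V)
    (hG : InGFamily ℓ G) (hcrit : VertexCritical 4 G)
    (K : OddK4 G) (hlong : K.longestPair)
    (hmin : ∀ K' : OddK4 G, K'.longestPair → K.diff ≤ K'.diff)
    (X : Set V) (hcut : IsVertexCut G X)
    (hmincut : ∀ X' ⊆ X, IsVertexCut G X' → X' = X)
    (h3 : K.u3 ∈ X) (h4 : K.u4 ∈ X)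
    (hXN : X ⊆ closedNbhd G {K.u3, K.u4})
    (hXH : X ∩ K.verts = {K.u3, K.u4})
    (S : Set V) (hS : IsComponentOf G X S)
    (hP2S : ∀ w ∈ interiorL K.P2, w ∈ S)
    : ∀ p : (G.induce (X ∪ S)).Walk ⟨K.u3, Set.mem_union_left S h3⟩
        ⟨K.u4, Set.mem_union_left S h4⟩,
      IsInducedPath (G.induce (X ∪ S)) p → p.length = K.P2.length := by
  exfalso
  have hvX : ∀ x ∈ K.verts, x ∈ X → x = K.u3 ∨ x = K.u4 := fun x hx hX => by
    have : x ∈ X ∩ K.verts := ⟨hX, hx⟩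
    rwa [hXH] at this
  have hu1 : K.u1 ∈ K.outer := .inl K.P1.start_mem_support
  obtain ⟨-, n13, n14, -⟩ := K.ne
  obtain ⟨D, h1, hDX, hclosed, hconn, hfull⟩ := exists_component_of_minimal_cut hcut hmincut
    (u := K.u1) fun h => (hvX _ (K.outer_subset_verts hu1) h).elim n13 n14
  have hoX : ∀ x ∈ K.outer, x ≠ K.u3 → x ≠ K.u4 → x ∉ X := fun x hx hx3 hx4 hX =>
    (hvX _ (K.outer_subset_verts hx) hX).elim hx3 hx4
  have hoD := K.outer_disjoint hoX hDX hclosed h1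
  obtain ⟨e1, e2, e3, e4⟩ := K.length_eq hG
  have hle := K.length_P2_le hG
  obtain ⟨l1, l2, l3, l4, -⟩ := id hlong
  refine hcrit.not_all_induced_paths_short hG.1 (m := K.P2.length) (by omega) (by omega) h3 h4
    hXN hclosed hconn hfull fun p hp hpXD =>
      K.length_eq_length_P2 hG (by omega) hlong hp fun x hx => ?_
  rcases hpXD x hx with hX | hD
  · by_cases hxK : x ∈ K.verts
    · exact (hvX x hxK hX).imp_right .inl
    refine .inr (.inr ⟨fun h => hxK (K.outer_subset_verts h), fun y hy hy3 hy4 => ?_⟩)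
    have hK3 : K.u3 ∈ K.verts := (hXH.symm.subset (.inl rfl)).2
    have hK4 : K.u4 ∈ K.verts := (hXH.symm.subset (.inr rfl)).2
    rcases hXN hX with (rfl | rfl) | ⟨u, rfl | rfl, hu⟩
    · exact (hxK hK3).elim
    · exact (hxK hK4).elim
    · exact K.not_adj_of_mem_outer hG (by omega) hxK (.inl rfl) hu.symm hy hy3
    · exact K.not_adj_of_mem_outer hG (by omega) hxK (.inr rfl) hu.symm hy hy4
  · exact .inr (.inr ⟨fun h => hoD x h hD, fun y hy hy3 hy4 hxy =>
      (hclosed x hD y hxy).elim (hoD y hy) (hoX y hy hy3 hy4)⟩)
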